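/- Let p ≥ 1, let G be a finite simple graph with independence number α(G) = 3, and let H be the complement of G. Then G is α-critical and belongs to W_p if and only if the following three conditions all hold: H is K_4-saturated; every maximal clique of H is a triangle; and every edge of H is contained in at least p triangles. Moreover, in this case the W-index w(G) equals the minimum, over edges e of H, of the number of triangles of H containing e. -/

import Mathlib

open Finset
open scoped Classical

/-- `S` is an independent set of the graph `G`. -/
def IsIndep {V : Type*} (G : SimpleGraph V) (S : Finset V) : Prop :=
  ∀ ⦃x⦄, x ∈ S → ∀ ⦃y⦄, y ∈ S → x ≠ y → ¬ G.Adj x y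

/-- The independence number `α(G)` of a finite graph `G`. -/
noncomputable def alpha {V : Type*} [Fintype V] (G : SimpleGraph V) : ℕ :=
  Finset.univ.sup fun S : Finset V => if IsIndep G S then S.card else 0

/-- `S` is a maximum independent set of `G`. -/
def IsMaxIndep {V : Type*} [Fintype V] (G : SimpleGraph V) (S : Finset V) : Prop :=
  IsIndep G S ∧ S.card = alpha G

/-- `S` is a maximal (inclusion-wise) independent set of `G`. -/
def IsMaximalIndep {V : Type*} [DecidableEq V] (G : SimpleGraph V) (S : Finset V) : Prop :=
  IsIndep G S ∧ ∀ x, x ∉ S → ¬ IsIndep G (insert x S)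

/-- `G` is well-covered: every maximal independent set has cardinality `α(G)`. -/
def WellCovered {V : Type*} [Fintype V] [DecidableEq V] (G : SimpleGraph V) : Prop :=
  ∀ S : Finset V, IsMaximalIndep G S → S.card = alpha G

/-- `G ∈ W_p`: `|V(G)| ≥ p` and every `p` pairwise disjoint independent sets extend to
`p` pairwise disjoint maximum independent sets. -/
def MemW {V : Type*} [Fintype V] (G : SimpleGraph V) (p : ℕ) : Prop :=
  p ≤ Fintype.card V ∧
    ∀ A : Fin p → Finset V, (∀ i, IsIndep G (A i)) →
      (∀ i j, i ≠ j → Disjoint (A i) (A j)) →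
      ∃ M : Fin p → Finset V, (∀ i, IsMaxIndep G (M i)) ∧
        (∀ i j, i ≠ j → Disjoint (M i) (M j)) ∧ ∀ i, A i ⊆ M i

/-- The `W`-index of `G`: the largest `p` with `G ∈ W_p`. -/
noncomputable def wIndex {V : Type*} [Fintype V] (G : SimpleGraph V) : ℕ :=
  sSup {p : ℕ | MemW G p}

/-- The fiber `F_G(S)`: the vertices `x ∉ S` with `S ∪ {x}` a maximum independent set. -/
noncomputable def fiber {V : Type*} [Fintype V] [DecidableEq V]
    (G : SimpleGraph V) (S : Finset V) : Finset V :=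
  Finset.univ.filter fun x => x ∉ S ∧ IsMaxIndep G (insert x S)

/-- `G` is `α`-critical: deleting any edge increases the independence number. -/
def AlphaCritical {V : Type*} [Fintype V] (G : SimpleGraph V) : Prop :=
  ∀ x y, G.Adj x y → alpha G < alpha (G.deleteEdges {s(x, y)})

/-- `H` is `K_t`-saturated: `H` is `K_t`-free but adding any missing edge creates a `K_t`. -/
def KSaturated {V : Type*} [Fintype V] (H : SimpleGraph V) (t : ℕ) : Prop :=
  (∀ Q : Finset V, ¬ H.IsNClique t Q) ∧
    ∀ x y : V, x ≠ y → ¬ H.Adj x y →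
      ∃ Q : Finset V, (H ⊔ SimpleGraph.fromEdgeSet {s(x, y)}).IsNClique t Q

/-- `Q` is an inclusion-maximal clique of `H`. -/
def IsMaximalClique {V : Type*} [DecidableEq V] (H : SimpleGraph V) (Q : Finset V) : Prop :=
  H.IsClique (Q : Set V) ∧ ∀ x, x ∉ Q → ¬ H.IsClique ((insert x Q : Finset V) : Set V)

/-- The `(r-1)`-clique-codegree of `Q` in `H`: the number of vertices extending `Q`
to an `r`-clique of `H`. -/
noncomputable def codeg {V : Type*} [Fintype V] [DecidableEq V]
    (H : SimpleGraph V) (r : ℕ) (Q : Finset V) : ℕ :=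
  (Finset.univ.filter fun x => x ∉ Q ∧ H.IsNClique r (insert x Q)).card

/-- The minimum `(r-1)`-clique-codegree `δ^cl_{r-1}(H)`. -/
noncomputable def minCliqueCodeg {V : Type*} [Fintype V] [DecidableEq V]
    (H : SimpleGraph V) (r : ℕ) : ℕ :=
  sInf {m : ℕ | ∃ Q : Finset V, H.IsNClique (r - 1) Q ∧ codeg H r Q = m}

/-- The vertex set of the localization `G_S = G - N_G[S]`. -/
noncomputable def localVerts {V : Type*} [Fintype V] (G : SimpleGraph V) (S : Finset V) :
    Finset V :=
  Finset.univ.filter fun v => v ∉ S ∧ ∀ s ∈ S, ¬ G.Adj s v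

/-- The localization `G_S = G - N_G[S]`, as an induced subgraph. -/
noncomputable def localize {V : Type*} [Fintype V] (G : SimpleGraph V) (S : Finset V) :
    SimpleGraph {v : V // v ∈ localVerts G S} :=
  SimpleGraph.comap (fun v => (v : V)) G

/-- The vertex set of the edge-localization `G_{ab} = G - (N_G(a) ∪ N_G(b))`. -/
noncomputable def edgeVerts {V : Type*} [Fintype V] (G : SimpleGraph V) (a b : V) : Finset V :=
  Finset.univ.filter fun v => ¬ G.Adj a v ∧ ¬ G.Adj b v

/-- The edge-localization `G_{ab} = G - (N_G(a) ∪ N_G(b))`, as an induced subgraph. -/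
noncomputable def edgeLocalize {V : Type*} [Fintype V] (G : SimpleGraph V) (a b : V) :
    SimpleGraph {v : V // v ∈ edgeVerts G a b} :=
  SimpleGraph.comap (fun v => (v : V)) G

section

variable {V : Type*}

theorem isIndep_iff_isClique_compl (G : SimpleGraph V) (S : Finset V) :
    IsIndep G S ↔ Gᶜ.IsClique (S : Set V) := by
  constructor
  · intro h x hx y hy hxy
    exact (SimpleGraph.compl_adj G x y).2 ⟨hxy, h hx hy hxy⟩
  · intro h x hx y hy hxy
    exact ((SimpleGraph.compl_adj G x y).1 (h hx hy hxy)).2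

theorem compl_deleteEdges_singleton (G : SimpleGraph V) (x y : V) :
    (G.deleteEdges {s(x, y)})ᶜ = Gᶜ ⊔ SimpleGraph.fromEdgeSet {s(x, y)} := by
  ext a b
  simp only [SimpleGraph.compl_adj, SimpleGraph.deleteEdges_adj, SimpleGraph.sup_adj,
    SimpleGraph.fromEdgeSet_adj, Set.mem_singleton_iff]
  tauto

variable [Fintype V]

theorem IsIndep.card_le_alpha {G : SimpleGraph V} {S : Finset V} (h : IsIndep G S) :
    S.card ≤ alpha G := by
  have := Finset.le_sup (f := fun S : Finset V => if IsIndep G S then S.card else 0)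
    (Finset.mem_univ S)
  rwa [if_pos h] at this

theorem exists_isMaxIndep (G : SimpleGraph V) : ∃ S, IsMaxIndep G S := by
  obtain ⟨S, -, hS⟩ := Finset.exists_mem_eq_sup (Finset.univ : Finset (Finset V))
    Finset.univ_nonempty (fun S => if IsIndep G S then S.card else 0)
  by_cases h : IsIndep G S
  · exact ⟨S, h, by rw [alpha, hS, if_pos h]⟩
  · refine ⟨∅, by simp [IsIndep], ?_⟩
    rw [alpha, hS, if_neg h, Finset.card_empty]

theorem le_alpha_iff_exists_isNClique (G : SimpleGraph V) (n : ℕ) :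
    n ≤ alpha G ↔ ∃ Q : Finset V, Gᶜ.IsNClique n Q := by
  constructor
  · intro h
    obtain ⟨S, hS, hcard⟩ := exists_isMaxIndep G
    obtain ⟨Q, hQS, hQ⟩ := Finset.exists_subset_card_eq (hcard ▸ h)
    exact ⟨Q, ((isIndep_iff_isClique_compl G S).1 hS).subset (by exact_mod_cast hQS), hQ⟩
  · rintro ⟨Q, hQ, rfl⟩
    exact ((isIndep_iff_isClique_compl G Q).2 hQ).card_le_alpha

/-- A graph with independence number `n` is `α`-critical iff its complement is
`K_{n+1}`-saturated. -/
theorem alphaCritical_iff_kSaturated_compl (G : SimpleGraph V) :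
    AlphaCritical G ↔ KSaturated Gᶜ (alpha G + 1) := by
  have key (x y : V) : alpha G < alpha (G.deleteEdges {s(x, y)}) ↔
      ∃ Q : Finset V, (Gᶜ ⊔ SimpleGraph.fromEdgeSet {s(x, y)}).IsNClique (alpha G + 1) Q := by
    rw [← compl_deleteEdges_singleton G x y, ← le_alpha_iff_exists_isNClique, Nat.succ_le_iff]
  constructor
  · refine fun h => ⟨fun Q hQ => ?_, fun x y hxy hadj => (key x y).1 (h x y ?_)⟩
    · exact absurd ((le_alpha_iff_exists_isNClique G _).2 ⟨Q, hQ⟩) (by omega)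
    · by_contra hG
      exact hadj ((SimpleGraph.compl_adj G x y).2 ⟨hxy, hG⟩)
  · intro h x y hadj
    exact (key x y).2 (h.2 x y hadj.ne fun hc => ((SimpleGraph.compl_adj G x y).1 hc).2 hadj)

variable [DecidableEq V]

theorem MemW.card_eq_alpha_of_isMaximalClique {G : SimpleGraph V} {q : ℕ} (hq : 1 ≤ q)
    (h : MemW G q) {Q : Finset V} (hQ : IsMaximalClique Gᶜ Q) : Q.card = alpha G := by
  have hQi := (isIndep_iff_isClique_compl G Q).2 hQ.1
  obtain ⟨M, hM, -, hQM⟩ := h.2 (fun i => if i.val = 0 then Q else ∅)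
    (fun i => by
      split_ifs
      · exact hQi
      · simp [IsIndep])
    (fun i j hij => by
      split_ifs with hi hj
      · exact absurd (Fin.ext (hi.trans hj.symm)) hij
      all_goals simp)
  have hsub : Q ⊆ M ⟨0, hq⟩ := by simpa using hQM ⟨0, hq⟩
  rw [← (hM ⟨0, hq⟩).2]
  congr 1
  refine hsub.antisymm fun x hx => ?_
  by_contra hxQ
  refine hQ.2 x hxQ (((isIndep_iff_isClique_compl G _).1 (hM ⟨0, hq⟩).1).subset ?_)
  exact_mod_cast Finset.insert_subset hx hsub

theorem MemW.le_card_common_neighbors {G : SimpleGraph V} (halpha : alpha G = 3) {q : ℕ}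
    (hq : 1 ≤ q) (h : MemW G q) {x y : V} (hxy : Gᶜ.Adj x y) :
    q ≤ (Finset.univ.filter fun z => Gᶜ.Adj x z ∧ Gᶜ.Adj y z).card := by
  by_contra! hlt
  set Z := Finset.univ.filter fun z => Gᶜ.Adj x z ∧ Gᶜ.Adj y z with hZ
  obtain ⟨g, hg, hgq⟩ : ∃ g : V → ℕ, Set.InjOn g Z ∧ ∀ z ∈ Z, 1 ≤ g z ∧ g z < q := by
    refine ⟨fun z => if hz : z ∈ Z then (Z.equivFin ⟨z, hz⟩).val + 1 else 0, ?_, ?_⟩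
    · intro a ha b hb hab
      have ha' : a ∈ Z := ha
      have hb' : b ∈ Z := hb
      simp only [ha', hb', dif_pos, Nat.add_right_cancel_iff] at hab
      simpa using Z.equivFin.injective (Fin.ext hab)
    · intro z hz
      simp only [hz, dif_pos]
      have := (Z.equivFin ⟨z, hz⟩).isLt
      omega
  have hxyZ : ∀ z ∈ Z, z ∉ ({x, y} : Finset V) := by
    intro z hz hzxy
    rw [hZ, Finset.mem_filter] at hz
    rcases Finset.mem_insert.1 hzxy with rfl | hzy
    · exact hz.2.1.ne rfl
    · exact hz.2.2.ne (Finset.mem_singleton.1 hzy).symm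
  have hpair : IsIndep G {x, y} := by
    rw [isIndep_iff_isClique_compl, Finset.coe_pair, SimpleGraph.isClique_pair]
    exact fun _ => hxy
  obtain ⟨M, hM, hdisj, hAM⟩ := h.2
    (fun i => if i.val = 0 then {x, y} else Z.filter fun z => g z = i.val)
    (fun i => by
      split_ifs
      · exact hpair
      · intro a ha b hb hab
        rw [Finset.mem_filter] at ha hb
        exact absurd (hg ha.1 hb.1 (ha.2.trans hb.2.symm)) hab)
    (fun i j hij => by
      rw [Finset.disjoint_left]
      intro a ha hb
      split_ifs at ha hb with hi hj hj
      · exact hij (Fin.ext (hi.trans hj.symm))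
      · exact hxyZ a (Finset.mem_filter.1 hb).1 ha
      · exact hxyZ a (Finset.mem_filter.1 ha).1 hb
      · exact hij (Fin.ext ((Finset.mem_filter.1 ha).2.symm.trans (Finset.mem_filter.1 hb).2)))
  have hsub : {x, y} ⊆ M ⟨0, hq⟩ := by simpa using hAM ⟨0, hq⟩
  have hcard : ({x, y} : Finset V).card < (M ⟨0, hq⟩).card := by
    rw [(hM ⟨0, hq⟩).2, halpha, Finset.card_pair hxy.ne]
    omega
  obtain ⟨z, hzM, hz⟩ := Finset.exists_mem_notMem_of_card_lt_card hcard
  have hclique := (isIndep_iff_isClique_compl G _).1 (hM ⟨0, hq⟩).1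
  have hx : x ∈ M ⟨0, hq⟩ := hsub (by simp)
  have hy : y ∈ M ⟨0, hq⟩ := hsub (by simp)
  have hzZ : z ∈ Z := by
    rw [hZ, Finset.mem_filter]
    refine ⟨Finset.mem_univ z, hclique hx hzM ?_, hclique hy hzM ?_⟩
    · rintro rfl; exact hz (by simp)
    · rintro rfl; exact hz (by simp)
  obtain ⟨h1, h2⟩ := hgq z hzZ
  have hzM' : z ∈ M ⟨g z, h2⟩ := by
    refine hAM ⟨g z, h2⟩ ?_
    rw [if_neg (by simp; omega)]
    exact Finset.mem_filter.2 ⟨hzZ, rfl⟩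
  refine Finset.disjoint_left.1 (hdisj ⟨0, hq⟩ ⟨g z, h2⟩ ?_) hzM hzM'
  rw [Ne, Fin.mk.injEq]
  omega

/-- Every clique extends to a maximal clique. -/
theorem exists_isMaximalClique_superset {H : SimpleGraph V} {A : Finset V}
    (hA : H.IsClique (A : Set V)) : ∃ Q, A ⊆ Q ∧ IsMaximalClique H Q := by
  obtain ⟨Q, hAQ, hQ⟩ :=
    (Set.toFinite {Q : Finset V | H.IsClique (Q : Set V)}).exists_le_maximal hA
  refine ⟨Q, hAQ, hQ.prop, fun x hx hc => hx ?_⟩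
  exact hQ.le_of_ge hc (Finset.subset_insert x Q) (Finset.mem_insert_self x Q)

/-- In a `K_4`-free graph, a member of a family of `q` cliques that is not a triangle extends
by a vertex missing the whole family, if every maximal clique is a triangle and every edge lies in
at least `q` triangles. -/
theorem exists_isClique_insert_notMem {H : SimpleGraph V} {q : ℕ}
    (hfree : ∀ Q : Finset V, ¬ H.IsNClique 4 Q)
    (hmax : ∀ Q : Finset V, IsMaximalClique H Q → Q.card = 3)
    (hedge : ∀ x y : V, H.Adj x y →
      q ≤ (Finset.univ.filter fun z => H.Adj x z ∧ H.Adj y z).card)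
    (M : Fin q → Finset V) (hM : ∀ i, H.IsClique (M i : Set V)) (i : Fin q)
    (hi : (M i).card < 3) :
    ∃ z, H.IsClique ((insert z (M i) : Finset V) : Set V) ∧ ∀ j, z ∉ M j := by
  obtain ⟨T, hMT, hT⟩ := exists_isMaximalClique_superset (hM i)
  have hT3 := hmax T hT
  obtain ⟨t, htT, htM⟩ := Finset.exists_mem_notMem_of_card_lt_card (hT3 ▸ hi)
  have h2 : (T.erase t).card = 2 := by rw [Finset.card_erase_of_mem htT, hT3]
  obtain ⟨x, y, hxy, hTxy⟩ := Finset.card_eq_two.1 h2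
  have hMxy : M i ⊆ {x, y} := hTxy ▸ Finset.subset_erase.2 ⟨hMT, htM⟩
  have hxT : x ∈ T := Finset.mem_of_mem_erase (hTxy ▸ Finset.mem_insert_self x {y})
  have hyT : y ∈ T := Finset.mem_of_mem_erase (hTxy ▸ by simp : y ∈ T.erase t)
  have hadj : H.Adj x y := hT.1 hxT hyT hxy
  set Z := Finset.univ.filter fun z => H.Adj x z ∧ H.Adj y z with hZ
  have hZmem (z : V) : z ∈ Z ↔ H.Adj x z ∧ H.Adj y z := by simp [hZ]
  have hZind : ∀ a ∈ Z, ∀ b ∈ Z, ¬ H.Adj a b := by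
    intro a ha b hb hab
    rw [hZmem] at ha hb
    have h3 : H.IsNClique 3 {y, a, b} := SimpleGraph.is3Clique_iff.2 ⟨y, a, b, ha.2, hb.2, hab, rfl⟩
    exact hfree _ (h3.insert (a := x) (by simp [hadj, ha.1, hb.1]))
  obtain ⟨z, hzZ, hz⟩ : ∃ z ∈ Z, ∀ j, z ∉ M j := by
    by_contra! hcon
    have : Nonempty (Fin q) := ⟨i⟩
    choose! f hf using hcon
    have hinj : Set.InjOn f Z := by
      intro a ha b hb hab
      by_contra hne
      exact hZind a ha b hb (hM (f a) (hf a ha) (hab ▸ hf b hb) hne)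
    have hne : ∀ z ∈ Z, f z ∈ Finset.univ.erase i := by
      intro z hz
      refine Finset.mem_erase.2 ⟨fun hfi => ?_, Finset.mem_univ _⟩
      have hzM := hMxy (hfi ▸ hf z hz)
      rw [hZmem] at hz
      rcases Finset.mem_insert.1 hzM with rfl | hzy
      · exact hz.1.ne rfl
      · exact hz.2.ne (Finset.mem_singleton.1 hzy).symm
    have hle := Finset.card_le_card_of_injOn f hne hinj
    rw [Finset.card_erase_of_mem (Finset.mem_univ i), Finset.card_univ, Fintype.card_fin] at hle
    have : q ≤ Z.card := by convert hedge x y hadj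
    have := i.isLt
    omega
  refine ⟨z, ?_, hz⟩
  rw [hZmem] at hzZ
  rw [Finset.coe_insert, SimpleGraph.isClique_insert]
  refine ⟨hM i, fun b hb _ => ?_⟩
  rcases Finset.mem_insert.1 (hMxy hb) with rfl | hby
  · exact hzZ.1.symm
  · exact Finset.mem_singleton.1 hby ▸ hzZ.2.symm

/-- For a graph with independence number `3`, membership in `W_q` in terms of the triangles of the
complement. -/
theorem memW_iff_of_alpha_eq_three (G : SimpleGraph V) (halpha : alpha G = 3) {q : ℕ}
    (hq : 1 ≤ q) :
    MemW G q ↔ (∀ Q : Finset V, IsMaximalClique Gᶜ Q → Q.card = 3) ∧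
      ∀ x y : V, Gᶜ.Adj x y →
        q ≤ (Finset.univ.filter fun z => Gᶜ.Adj x z ∧ Gᶜ.Adj y z).card := by
  refine ⟨fun h => ⟨fun Q hQ => halpha ▸ h.card_eq_alpha_of_isMaximalClique hq hQ,
    fun x y hxy => h.le_card_common_neighbors halpha hq hxy⟩, fun ⟨hmax, hedge⟩ => ⟨?_, ?_⟩⟩
  · obtain ⟨T, hT⟩ := (le_alpha_iff_exists_isNClique G 3).1 halpha.ge
    obtain ⟨x, y, z, hxy, -⟩ := SimpleGraph.is3Clique_iff.1 hT
    exact (hedge x y hxy).trans (Finset.card_le_univ _)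
  · intro A hA hdisj
    obtain ⟨M, hAM, hM⟩ := (Set.toFinite {M : Fin q → Finset V |
      (∀ i, Gᶜ.IsClique (M i : Set V)) ∧ ∀ i j, i ≠ j → Disjoint (M i) (M j)}).exists_le_maximal
      (a := A) ⟨fun i => (isIndep_iff_isClique_compl G _).1 (hA i), hdisj⟩
    have hind i := (isIndep_iff_isClique_compl G _).2 (hM.prop.1 i)
    refine ⟨M, fun i => ⟨hind i, (hind i).card_le_alpha.antisymm ?_⟩, hM.prop.2, hAM⟩
    by_contra! hlt
    have hfree (Q : Finset V) : ¬ Gᶜ.IsNClique 4 Q := fun hQ => by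
      have := (le_alpha_iff_exists_isNClique G 4).2 ⟨Q, hQ⟩
      omega
    obtain ⟨z, hzc, hz⟩ :=
      exists_isClique_insert_notMem hfree hmax (fun x y hxy => by convert hedge x y hxy) M
        hM.prop.1 i (halpha ▸ hlt)
    have hle : M ≤ Function.update M i (insert z (M i)) :=
      le_update_iff.2 ⟨Finset.subset_insert z (M i), fun _ _ => le_rfl⟩
    have hge := hM.le_of_ge (y := Function.update M i (insert z (M i))) ⟨?_, ?_⟩ hle i
    · rw [Function.update_self] at hge
      exact hz i (hge (Finset.mem_insert_self z (M i)))
    · intro j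
      rcases eq_or_ne j i with rfl | hj
      · rwa [Function.update_self]
      · rw [Function.update_of_ne hj]
        exact hM.prop.1 j
    · intro j k hjk
      rcases eq_or_ne j i with rfl | hj
      · rw [Function.update_self, Function.update_of_ne hjk.symm, Finset.disjoint_insert_left]
        exact ⟨hz k, hM.prop.2 j k hjk⟩
      · rw [Function.update_of_ne hj]
        rcases eq_or_ne k i with rfl | hk
        · rw [Function.update_self, Finset.disjoint_insert_right]
          exact ⟨hz j, hM.prop.2 j k hjk⟩
        · rw [Function.update_of_ne hk]
          exact hM.prop.2 j k hjk

end

/-- The case `α(G) = 3`. -/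
theorem alphaCritical_and_wp_iff_alpha_three {V : Type*} [Fintype V] [DecidableEq V]
    (G : SimpleGraph V) (p : ℕ) (hp : 1 ≤ p) (halpha : alpha G = 3) :
    ((AlphaCritical G ∧ MemW G p) ↔
      (KSaturated Gᶜ 4 ∧
        (∀ Q : Finset V, IsMaximalClique Gᶜ Q → Q.card = 3) ∧
        ∀ x y : V, Gᶜ.Adj x y →
          p ≤ (Finset.univ.filter fun z => Gᶜ.Adj x z ∧ Gᶜ.Adj y z).card)) ∧
      ((AlphaCritical G ∧ MemW G p) →
        wIndex G = sInf {m : ℕ | ∃ x y : V, Gᶜ.Adj x y ∧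
          (Finset.univ.filter fun z => Gᶜ.Adj x z ∧ Gᶜ.Adj y z).card = m}) := by
  have hcrit := alphaCritical_iff_kSaturated_compl G
  rw [halpha] at hcrit
  refine ⟨by rw [hcrit, memW_iff_of_alpha_eq_three G halpha hp], fun ⟨_, hW⟩ => ?_⟩
  obtain ⟨hmax, hedge⟩ := (memW_iff_of_alpha_eq_three G halpha hp).1 hW
  set D := {m : ℕ | ∃ x y : V, Gᶜ.Adj x y ∧
    (Finset.univ.filter fun z => Gᶜ.Adj x z ∧ Gᶜ.Adj y z).card = m} with hD
  have hDne : D.Nonempty := by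
    obtain ⟨T, hT⟩ := (le_alpha_iff_exists_isNClique G 3).1 halpha.ge
    obtain ⟨x, y, z, hxy, -⟩ := SimpleGraph.is3Clique_iff.1 hT
    exact ⟨_, x, y, hxy, rfl⟩
  obtain ⟨x, y, hxy, hm⟩ := Nat.sInf_mem hDne
  refine IsGreatest.csSup_eq ⟨?_, fun q hq => ?_⟩
  · exact (memW_iff_of_alpha_eq_three G halpha (hp.trans (hm ▸ hedge x y hxy))).2
      ⟨hmax, fun a b hab => Nat.sInf_le ⟨a, b, hab, rfl⟩⟩
  · rcases Nat.eq_zero_or_pos q with rfl | hq0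
    · exact Nat.zero_le _
    · exact hm ▸ ((memW_iff_of_alpha_eq_three G halpha hq0).1 hq).2 x y hxy
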